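/- Let r ≥ 1 and let n_1, ..., n_r be integers with 1 < n_1 | n_2 | ... | n_r = n, let G = C_{n_1} ⊕ ... ⊕ C_{n_r} and Q = C_{n/n_1} ⊕ ... ⊕ C_{n/n_r}. Let c > 0 be a real number such that η(C_p^r) ≤ c·(p − 1) + 1 for every prime p, where C_p^r denotes the direct sum of r copies of C_p. Then k(G) ≤ c·(α(n) − β(n)) + r·β(n) − k*(Q)/n; moreover, if gcd(n_i, n/n_i) = 1 for every i (so that G is a direct summand of C_n^r), then k(G) ≤ c·(α(n) − β(n)) + r·β(n) − k*(Q). -/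

import Mathlib

open scoped BigOperators

attribute [local instance] Classical.propDecidable

/-- A sequence (multiset) over `G` is zero-sumfree if no nonempty sub-multiset sums to `0`. -/
def IsZeroSumFree {G : Type*} [AddCommGroup G] (S : Multiset G) : Prop :=
  ∀ T : Multiset G, T ≤ S → T ≠ 0 → T.sum ≠ 0

/-- A minimal zero-sum sequence: sum `0`, and no nonempty proper sub-multiset sums to `0`. -/
def IsMinimalZeroSum {G : Type*} [AddCommGroup G] (S : Multiset G) : Prop :=
  S.sum = 0 ∧ ∀ T : Multiset G, T < S → T ≠ 0 → T.sum ≠ 0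

/-- The cross number of a sequence: `k(S) = Σ_{g ∈ S} 1/ord(g)`. -/
noncomputable def crossNumber {G : Type*} [AddCommGroup G] (S : Multiset G) : ℝ :=
  (S.map fun g => (1 : ℝ) / (addOrderOf g)).sum

/-- The little cross number `k(G)`: max of `k(S)` over zero-sumfree sequences `S` over `G`. -/
noncomputable def littleCrossNumber (G : Type*) [AddCommGroup G] : ℝ :=
  sSup {x : ℝ | ∃ S : Multiset G, IsZeroSumFree S ∧ crossNumber S = x}

/-- The cross number `K(G)`: max of `k(S)` over minimal zero-sum sequences `S` over `G`. -/
noncomputable def bigCrossNumber (G : Type*) [AddCommGroup G] : ℝ :=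
  sSup {x : ℝ | ∃ S : Multiset G, IsMinimalZeroSum S ∧ crossNumber S = x}

/-- The Davenport constant `D(G)`. -/
noncomputable def davenport (G : Type*) [AddCommGroup G] : ℕ :=
  sInf {t | 1 ≤ t ∧ ∀ S : Multiset G, t ≤ Multiset.card S →
    ∃ T, T ≤ S ∧ T ≠ 0 ∧ T.sum = 0}

/-- The constant `η(G)`. -/
noncomputable def etaConst (G : Type*) [AddCommGroup G] : ℕ :=
  sInf {t | 1 ≤ t ∧ ∀ S : Multiset G, t ≤ Multiset.card S →
    ∃ T, T ≤ S ∧ T ≠ 0 ∧ Multiset.card T ≤ AddMonoid.exponent G ∧ T.sum = 0}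

/-- `υ_i(d',d) = A_i / gcd(A_i, B_i)` where `A_i = gcd(d', n_i)` and
`B_i = lcm(d, n_i)/lcm(d', n_i)`. -/
def upsilon (ni d' d : ℕ) : ℕ :=
  Nat.gcd d' ni / Nat.gcd (Nat.gcd d' ni) (Nat.lcm d ni / Nat.lcm d' ni)

/-- `k*` of `C_{n_1} ⊕ ... ⊕ C_{n_r}`, computed from the primary decomposition. -/
noncomputable def kStarTuple {r : ℕ} (n : Fin r → ℕ) : ℝ :=
  ∑ i, ∑ p ∈ (n i).primeFactors,
    ((p ^ ((n i).factorization p) : ℝ) - 1) / (p ^ ((n i).factorization p))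

/-- `α(n) = Σ_{d | n} (P⁻(d) − 1)/d`. -/
noncomputable def alphaFn (n : ℕ) : ℝ :=
  ∑ d ∈ n.divisors, ((d.minFac : ℝ) - 1) / d

/-- `β(n) = Σ_{p | n prime} (p − 1)/p`. -/
noncomputable def betaFn (n : ℕ) : ℝ :=
  ∑ p ∈ n.primeFactors, ((p : ℝ) - 1) / p

theorem Multiset.exists_le_map_eq_of_le_map {α β : Type*} {f : α → β} {S : Multiset α}
    {T : Multiset β} (h : T ≤ S.map f) : ∃ U ≤ S, U.map f = T := by
  have hT : T ∈ Multiset.powersetCard (Multiset.card T) (S.map f) :=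
    Multiset.mem_powersetCard.2 ⟨h, rfl⟩
  rw [Multiset.powersetCard_map, Multiset.mem_map] at hT
  obtain ⟨U, hU, hUT⟩ := hT
  exact ⟨U, (Multiset.mem_powersetCard.1 hU).1, hUT⟩

section ZeroSumFree

variable {G H : Type*} [AddCommGroup G] [AddCommGroup H]

theorem isZeroSumFree_zero : IsZeroSumFree (0 : Multiset G) := fun _ hT hT0 =>
  absurd (Multiset.le_zero.1 hT) hT0

theorem IsZeroSumFree.ne_zero {S : Multiset G} (hS : IsZeroSumFree S) {g : G} (hg : g ∈ S) :
    g ≠ 0 := by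
  simpa using hS {g} (Multiset.singleton_le.2 hg) (Multiset.singleton_ne_zero g)

theorem IsZeroSumFree.map {S : Multiset G} (hS : IsZeroSumFree S) {f : G →+ H}
    (hf : Function.Injective f) : IsZeroSumFree (S.map f) := by
  intro T hT hT0
  obtain ⟨U, hU, rfl⟩ := Multiset.exists_le_map_eq_of_le_map hT
  rw [← map_multiset_sum, map_ne_zero_iff f hf]
  exact hS U hU (by rintro rfl; simp at hT0)

/-- Replacing a nonempty subsequence by its sum preserves zero-sumfreeness. -/
theorem IsZeroSumFree.sum_cons {R T : Multiset G} (hS : IsZeroSumFree (R + T)) (hT : T ≠ 0) :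
    IsZeroSumFree (T.sum ::ₘ R) := by
  intro U hU hU0
  by_cases hmem : T.sum ∈ U
  · have hle : U.erase T.sum ≤ R := Multiset.erase_le_iff_le_cons.2 hU
    rw [← Multiset.cons_erase hmem, Multiset.sum_cons, add_comm, ← Multiset.sum_add]
    exact hS _ (add_le_add_left hle T) (by simp [hT])
  · exact hS U (((Multiset.le_cons_of_notMem hmem).1 hU).trans (Multiset.le_add_right R T)) hU0

/-- A zero-sumfree sequence killed by `f` can be extended by `q - 1` copies of an element whose
image under `f` has order `q`. -/
theorem IsZeroSumFree.add_replicate {S : Multiset G} (hS : IsZeroSumFree S) (f : G →+ H)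
    (hf : ∀ g ∈ S, f g = 0) {x : G} {q : ℕ} (hq : 0 < q) (hx : addOrderOf (f x) = q) :
    IsZeroSumFree (S + Multiset.replicate (q - 1) x) := by
  intro U hU hU0 hsum
  have hB : U - S ≤ Multiset.replicate (q - 1) x := tsub_le_iff_left.2 hU
  obtain ⟨k, hk, hUk⟩ := Multiset.le_replicate_iff.1 hB
  have hdecomp : U - S + U ∩ S = U := Multiset.sub_add_inter U S
  have hzero : f (U ∩ S).sum = 0 := by
    rw [map_multiset_sum]
    refine Multiset.sum_eq_zero fun y hy => ?_
    obtain ⟨g, hg, rfl⟩ := Multiset.mem_map.1 hy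
    exact hf g (Multiset.mem_of_le Multiset.inter_le_right hg)
  have hkx : k • f x = 0 := by
    have := congrArg f hsum
    rw [← hdecomp, hUk, Multiset.sum_add, map_add, hzero, Multiset.sum_replicate, map_nsmul,
      add_zero, map_zero] at this
    exact this
  have hk0 : k = 0 := Nat.eq_zero_of_dvd_of_lt (hx ▸ addOrderOf_dvd_of_nsmul_eq_zero hkx) (by omega)
  subst hk0
  have hUS : U ≤ S := by
    rw [Multiset.replicate_zero] at hUk
    exact tsub_eq_zero_iff_le.1 hUk
  exact hS U hUS hU0 hsum

theorem IsZeroSumFree.add_sum_replicate {ι : Type*} {S : Multiset G} (hS : IsZeroSumFree S)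
    {K : ι → Type*} [∀ a, AddCommGroup (K a)] (F : Finset ι) (f : ∀ a, G →+ K a) (x : ι → G)
    (q : ι → ℕ) (hfS : ∀ a ∈ F, ∀ g ∈ S, f a g = 0)
    (hfx : ∀ a ∈ F, ∀ b ∈ F, b ≠ a → f a (x b) = 0)
    (hq : ∀ a ∈ F, 0 < q a) (hx : ∀ a ∈ F, addOrderOf (f a (x a)) = q a) :
    IsZeroSumFree (S + ∑ a ∈ F, Multiset.replicate (q a - 1) (x a)) := by
  classical
  induction F using Finset.induction_on with
  | empty => simpa using hS
  | insert a F ha ih =>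
    rw [Finset.sum_insert ha, add_comm (Multiset.replicate _ _), ← add_assoc]
    refine (ih (fun b hb => hfS b (Finset.mem_insert_of_mem hb))
      (fun b hb e he => hfx b (Finset.mem_insert_of_mem hb) e (Finset.mem_insert_of_mem he))
      (fun b hb => hq b (Finset.mem_insert_of_mem hb))
      (fun b hb => hx b (Finset.mem_insert_of_mem hb))).add_replicate (f a) ?_
      (hq a (Finset.mem_insert_self a F)) (hx a (Finset.mem_insert_self a F))
    intro g hg
    rcases Multiset.mem_add.1 hg with hg | hg
    · exact hfS a (Finset.mem_insert_self a F) g hg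
    · obtain ⟨b, hb, hgb⟩ := Multiset.mem_sum.1 hg
      rw [Multiset.eq_of_mem_replicate hgb]
      exact hfx a (Finset.mem_insert_self a F) b (Finset.mem_insert_of_mem hb)
        (ne_of_mem_of_not_mem hb ha)

end ZeroSumFree

section CrossNumber

variable {G : Type*} [AddCommGroup G]

theorem crossNumber_cons (g : G) (S : Multiset G) :
    crossNumber (g ::ₘ S) = 1 / addOrderOf g + crossNumber S := by
  simp [crossNumber]

theorem crossNumber_add (S T : Multiset G) :
    crossNumber (S + T) = crossNumber S + crossNumber T := by
  simp [crossNumber]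

theorem crossNumber_replicate (k : ℕ) (g : G) :
    crossNumber (Multiset.replicate k g) = k / addOrderOf g := by
  simp [crossNumber, div_eq_mul_inv]

theorem crossNumber_sum {ι : Type*} (F : Finset ι) (S : ι → Multiset G) :
    crossNumber (∑ a ∈ F, S a) = ∑ a ∈ F, crossNumber (S a) := by
  classical
  induction F using Finset.induction_on with
  | empty => simp [crossNumber]
  | insert a F ha ih => rw [Finset.sum_insert ha, Finset.sum_insert ha, crossNumber_add, ih]

theorem crossNumber_map {H : Type*} [AddCommGroup H] {f : G →+ H} (hf : Function.Injective f)
    (S : Multiset G) : crossNumber (S.map f) = crossNumber S := by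
  simp only [crossNumber, Multiset.map_map, Function.comp_def, addOrderOf_injective f hf]

theorem crossNumber_eq_card_div {T : Multiset G} {d : ℕ} (h : ∀ g ∈ T, addOrderOf g = d) :
    crossNumber T = (Multiset.card T : ℝ) / d := by
  rw [crossNumber, Multiset.map_congr rfl fun g hg => by rw [h g hg], Multiset.map_const',
    Multiset.sum_replicate, nsmul_eq_mul, mul_one_div]

theorem crossNumber_eq_sum_divisors {N : ℕ} (hN : N ≠ 0) (S : Multiset G)
    (h : ∀ g ∈ S, addOrderOf g ∣ N) :
    crossNumber S =
      ∑ d ∈ N.divisors, (Multiset.card (S.filter fun g => addOrderOf g = d) : ℝ) / d := by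
  induction S using Multiset.induction_on with
  | empty => simp [crossNumber]
  | cons g S ih =>
    rw [crossNumber_cons, ih fun x hx => h x (Multiset.mem_cons_of_mem hx)]
    have hg : addOrderOf g ∈ N.divisors :=
      Nat.mem_divisors.2 ⟨h g (Multiset.mem_cons_self g S), hN⟩
    have hone : (1 : ℝ) / addOrderOf g =
        ∑ d ∈ N.divisors, (if addOrderOf g = d then (1 : ℝ) else 0) / d := by
      simp only [ite_div, zero_div]
      rw [Finset.sum_ite_eq, if_pos hg]
    rw [hone, ← Finset.sum_add_distrib]
    refine Finset.sum_congr rfl fun d _ => ?_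
    rw [Multiset.filter_cons, Multiset.card_add, ← add_div]
    split_ifs <;> simp

end CrossNumber

/-- The Davenport constant of `C_p ^ r` is at most `r * (p - 1) + 1`. -/
theorem exists_zero_sum_of_lt_card {r p : ℕ} [Fact p.Prime] (S : Multiset (Fin r → ZMod p))
    (h : r * (p - 1) < Multiset.card S) : ∃ T ≤ S, T ≠ 0 ∧ T.sum = 0 := by
  classical
  obtain ⟨l, rfl⟩ := Quot.exists_rep S
  let m := l.length
  have hl : (Finset.univ : Finset (Fin m)).val.map l.get = (l : Multiset (Fin r → ZMod p)) := by
    rw [Fin.univ_val_map, List.ofFn_get]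
  let P : Fin r → MvPolynomial (Fin m) (ZMod p) := fun i =>
    ∑ j, MvPolynomial.C (l.get j i) * MvPolynomial.X j ^ (p - 1)
  have hdeg : ∑ i, (P i).totalDegree < Fintype.card (Fin m) := by
    refine lt_of_le_of_lt (Finset.sum_le_card_nsmul Finset.univ _ (p - 1) fun i _ => ?_) ?_
    · refine MvPolynomial.totalDegree_finsetSum_le fun j _ => ?_
      refine (MvPolynomial.totalDegree_mul _ _).trans ?_
      rw [MvPolynomial.totalDegree_C, MvPolynomial.totalDegree_X_pow, zero_add]
    · simpa [m] using h
  have hcard := char_dvd_card_solutions_of_fintype_sum_lt p hdeg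
  have hp1 : p - 1 ≠ 0 := by have := (Fact.out : p.Prime).two_le; omega
  have heval : ∀ (y : Fin m → ZMod p) i, MvPolynomial.eval y (P i) =
      ∑ j, l.get j i * y j ^ (p - 1) := fun y i => by simp [P]
  let y0 : {y : Fin m → ZMod p // ∀ i, MvPolynomial.eval y (P i) = 0} :=
    ⟨0, fun i => by rw [heval]; simp [hp1]⟩
  replace hcard : p ∣ Fintype.card
      {y : Fin m → ZMod p // ∀ i, MvPolynomial.eval y (P i) = 0} := by
    convert hcard
  have hgt : 1 < Fintype.card {y : Fin m → ZMod p // ∀ i, MvPolynomial.eval y (P i) = 0} :=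
    (Fact.out : p.Prime).one_lt.trans_le (Nat.le_of_dvd (Fintype.card_pos_iff.2 ⟨y0⟩) hcard)
  obtain ⟨⟨y, hy⟩, hne⟩ := Fintype.exists_ne_of_one_lt_card hgt y0
  have hy0 : y ≠ 0 := fun h0 => hne (Subtype.ext h0)
  let F : Finset (Fin m) := Finset.univ.filter fun j => y j ≠ 0
  refine ⟨F.val.map l.get, ?_, ?_, ?_⟩
  · exact (Multiset.map_le_map (Finset.val_le_iff.2 (Finset.subset_univ F))).trans hl.le
  · obtain ⟨j, hj⟩ := Function.ne_iff.1 hy0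
    intro h0
    have hjF : j ∈ F := by simpa [F] using hj
    rw [Multiset.map_eq_zero, Finset.val_eq_zero] at h0
    simp [h0] at hjF
  · change ∑ j ∈ F, l.get j = 0
    funext i
    rw [Finset.sum_apply, Pi.zero_apply, ← hy i, heval, Finset.sum_filter]
    refine Finset.sum_congr rfl fun j _ => ?_
    by_cases hj : y j = 0
    · simp [hj, hp1]
    · simp [hj, ZMod.pow_card_sub_one_eq_one hj]

theorem exponent_pi_zmod_prime {r p : ℕ} (hr : 0 < r) (hp : p.Prime) :
    AddMonoid.exponent (Fin r → ZMod p) = p := by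
  have := Fact.mk hp
  have : Nonempty (Fin r) := ⟨⟨0, hr⟩⟩
  refine (AddMonoid.exponent_eq_prime_iff hp).2 fun g hg => addOrderOf_eq_prime ?_ hg
  funext i
  simp

/-- The infimum defining `η` is attained. -/
theorem exists_short_zero_sum {G : Type*} [AddCommGroup G] [Finite G] (S : Multiset G)
    (h : etaConst G ≤ Multiset.card S) :
    ∃ T ≤ S, T ≠ 0 ∧ Multiset.card T ≤ AddMonoid.exponent G ∧ T.sum = 0 := by
  classical
  have := Fintype.ofFinite G
  have hexp : 0 < AddMonoid.exponent G := AddMonoid.exponent_pos.2 .of_finite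
  have hne : {t | 1 ≤ t ∧ ∀ S : Multiset G, t ≤ Multiset.card S →
      ∃ T, T ≤ S ∧ T ≠ 0 ∧ Multiset.card T ≤ AddMonoid.exponent G ∧ T.sum = 0}.Nonempty := by
    refine ⟨Fintype.card G * AddMonoid.exponent G, ?_, fun S hS => ?_⟩
    · exact Nat.mul_pos Fintype.card_pos hexp
    obtain ⟨g, -, hg⟩ : ∃ g ∈ (Finset.univ : Finset G), AddMonoid.exponent G ≤ S.count g := by
      refine Finset.exists_le_of_sum_le ⟨0, Finset.mem_univ 0⟩ ?_
      rw [Finset.sum_const, Finset.card_univ, smul_eq_mul,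
        Multiset.sum_count_eq_card fun a _ => Finset.mem_univ a]
      exact hS
    refine ⟨Multiset.replicate (AddMonoid.exponent G) g, Multiset.le_count_iff_replicate_le.1 hg,
      ?_, by simp, by simp [AddMonoid.exponent_nsmul_eq_zero]⟩
    rw [Ne, ← Multiset.card_eq_zero, Multiset.card_replicate]
    exact hexp.ne'
  exact (Nat.sInf_mem hne).2 S h

/-- For `x` with `d • x = 0` in `C_N ^ r`, the class of `x` in `G_d / G_{d/p} ≅ C_p ^ r`. -/
def layerMap {r : ℕ} (N d p : ℕ) (x : Fin r → ZMod N) : Fin r → ZMod p :=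
  fun i => ((x i).val / (N / d) : ℕ)

theorem nsmul_sum_eq_zero_of_layerMap {r N d p : ℕ} (hN : N ≠ 0) (hd : d ∣ N) (hp : p ∣ d)
    {T : Multiset (Fin r → ZMod N)} (hT : ∀ x ∈ T, d • x = 0)
    (h : (T.map (layerMap N d p)).sum = 0) : (d / p) • T.sum = 0 := by
  have := NeZero.mk hN
  have hd0 : 0 < d := Nat.pos_of_dvd_of_pos hd (Nat.pos_of_ne_zero hN)
  funext i
  let M : ℕ := (T.map fun x => (x i).val / (N / d)).sum
  have hmod : ((M : ℕ) : ZMod p) = 0 := by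
    have := congrFun h i
    rw [Pi.multiset_sum_apply, Multiset.map_map] at this
    simpa [M, layerMap, Nat.cast_multiset_sum, Multiset.map_map, Function.comp_def] using this
  have hsum : T.sum i = ((N / d * M : ℕ) : ZMod N) := by
    rw [Pi.multiset_sum_apply, ← Multiset.sum_map_mul_left, Nat.cast_multiset_sum,
      Multiset.map_map]
    refine congrArg Multiset.sum (Multiset.map_congr rfl fun x hx => ?_)
    have hxi : ((d * (x i).val : ℕ) : ZMod N) = 0 := by
      have := congrFun (hT x hx) i
      simpa using this
    have hdvd : N / d ∣ (x i).val := by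
      refine Nat.dvd_of_mul_dvd_mul_left hd0 ?_
      rw [Nat.mul_div_cancel' hd]
      exact (ZMod.natCast_eq_zero_iff _ _).1 hxi
    rw [Function.comp_apply, Nat.mul_div_cancel' hdvd, ZMod.natCast_zmod_val]
  obtain ⟨k, hk⟩ := (ZMod.natCast_eq_zero_iff _ _).1 hmod
  rw [Pi.smul_apply, hsum, Pi.zero_apply, nsmul_eq_mul, ← Nat.cast_mul, ZMod.natCast_eq_zero_iff]
  refine ⟨k, ?_⟩
  calc d / p * (N / d * M) = (d / p * p) * (N / d) * k := by rw [hk]; ring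
    _ = N * k := by rw [Nat.div_mul_cancel hp, Nat.mul_div_cancel' hd]

/-- A subsequence of elements of order `d` whose sum has order dividing `d / p` and whose length is
at most `p` can be contracted without decreasing the cross number. -/
theorem crossNumber_le_inv_addOrderOf_sum {G : Type*} [AddCommGroup G] {d p : ℕ} (hd : 0 < d)
    (hp : p ∣ d) {T : Multiset G} (hT : ∀ g ∈ T, addOrderOf g = d)
    (hcard : Multiset.card T ≤ p) (hsum : (d / p) • T.sum = 0) :
    crossNumber T ≤ 1 / addOrderOf T.sum := by
  have hp0 : 0 < p := Nat.pos_of_dvd_of_pos hp hd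
  have hdp : 0 < d / p := Nat.div_pos (Nat.le_of_dvd hd hp) hp0
  have hdvd := addOrderOf_dvd_of_nsmul_eq_zero hsum
  have hpos : 0 < addOrderOf T.sum := Nat.pos_of_dvd_of_pos hdvd hdp
  have hle : addOrderOf T.sum * p ≤ d :=
    (Nat.mul_le_mul_right p (Nat.le_of_dvd hdp hdvd)).trans (Nat.div_mul_le_self d p)
  rw [crossNumber_eq_card_div hT, div_le_div_iff₀ (by exact_mod_cast hd) (by exact_mod_cast hpos),
    one_mul, mul_comm]
  exact_mod_cast (Nat.mul_le_mul_left _ hcard).trans hle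

theorem crossNumber_le_of_isZeroSumFree {r N : ℕ} (hr : 0 < r) (hN : N ≠ 0) (c : ℝ)
    (hcEta : ∀ p : ℕ, p.Prime → (etaConst (Fin r → ZMod p) : ℝ) ≤ c * (p - 1) + 1)
    (S : Multiset (Fin r → ZMod N)) (hS : IsZeroSumFree S) :
    crossNumber S ≤ c * (alphaFn N - betaFn N) + r * betaFn N := by
  have hNord : ∀ g : Fin r → ZMod N, addOrderOf g ∣ N := fun g =>
    addOrderOf_dvd_of_nsmul_eq_zero (by funext i; simp)
  induction hm : Multiset.card S using Nat.strong_induction_on generalizing S with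
  | _ m ih =>
  by_cases hlong : ∃ d ∈ N.divisors, d ≠ 1 ∧ c * (d.minFac - 1) <
      Multiset.card (S.filter fun g => addOrderOf g = d)
  · obtain ⟨d, hdN, hd1, hlt⟩ := hlong
    have hp : d.minFac.Prime := Nat.minFac_prime hd1
    have := Fact.mk hp
    have hd0 : 0 < d := Nat.pos_of_mem_divisors hdN
    have hdp : 0 < d / d.minFac := Nat.div_pos (Nat.minFac_le hd0) hp.pos
    have heta : etaConst (Fin r → ZMod d.minFac) ≤ Multiset.card
        ((S.filter fun g => addOrderOf g = d).map (layerMap N d d.minFac)) := by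
      rw [Multiset.card_map]
      have := hcEta _ hp
      have hlt' : (etaConst (Fin r → ZMod d.minFac) : ℝ) <
          Multiset.card (S.filter fun g => addOrderOf g = d) + 1 := by linarith
      exact Nat.lt_succ_iff.1 (by exact_mod_cast hlt')
    obtain ⟨T', hT', hT'0, hT'card, hT'sum⟩ := exists_short_zero_sum _ heta
    rw [exponent_pi_zmod_prime hr hp] at hT'card
    obtain ⟨T, hT, rfl⟩ := Multiset.exists_le_map_eq_of_le_map hT'
    rw [Multiset.card_map] at hT'card
    have hT0 : T ≠ 0 := by rintro rfl; simp at hT'0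
    have hord : ∀ g ∈ T, addOrderOf g = d := fun g hg =>
      (Multiset.mem_filter.1 (Multiset.mem_of_le hT hg)).2
    have hsum : (d / d.minFac) • T.sum = 0 :=
      nsmul_sum_eq_zero_of_layerMap hN (Nat.dvd_of_mem_divisors hdN) (Nat.minFac_dvd d)
        (fun x hx => hord x hx ▸ addOrderOf_nsmul_eq_zero x) hT'sum
    obtain ⟨R, hR⟩ := Multiset.le_iff_exists_add.1 (hT.trans (Multiset.filter_le _ S))
    rw [add_comm] at hR
    have hTcard : 1 < Multiset.card T := by
      refine lt_of_le_of_ne (Multiset.card_pos.2 hT0) fun h1 => ?_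
      obtain ⟨g, rfl⟩ := Multiset.card_eq_one.1 h1.symm
      rw [Multiset.sum_singleton] at hsum
      have hle := Nat.le_of_dvd hdp (addOrderOf_dvd_of_nsmul_eq_zero hsum)
      rw [hord g (Multiset.mem_singleton_self g)] at hle
      exact absurd (Nat.div_lt_self hd0 hp.one_lt) (not_lt.2 hle)
    have hcr := crossNumber_le_inv_addOrderOf_sum hd0 (Nat.minFac_dvd d) hord hT'card hsum
    have hfree : IsZeroSumFree (T.sum ::ₘ R) := IsZeroSumFree.sum_cons (hR ▸ hS) hT0
    refine le_trans ?_ (ih (Multiset.card (T.sum ::ₘ R)) ?_ _ hfree rfl)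
    · rw [hR, crossNumber_add, crossNumber_cons]
      linarith
    · rw [← hm, hR, Multiset.card_add, Multiset.card_cons]
      omega
  · push Not at hlong
    have hprime : ∀ p ∈ N.primeFactors,
        (Multiset.card (S.filter fun g => addOrderOf g = p) : ℝ) ≤ r * (p - 1) := by
      intro p hpN
      have hp := Nat.prime_of_mem_primeFactors hpN
      have := Fact.mk hp
      by_contra! hlt
      have hlt' : r * (p - 1) < Multiset.card
          ((S.filter fun g => addOrderOf g = p).map (layerMap N p p)) := by
        rw [Multiset.card_map, ← Nat.cast_lt (α := ℝ), Nat.cast_mul, Nat.cast_pred hp.pos]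
        exact hlt
      obtain ⟨T', hT', hT'0, hT'sum⟩ := exists_zero_sum_of_lt_card _ hlt'
      obtain ⟨T, hT, rfl⟩ := Multiset.exists_le_map_eq_of_le_map hT'
      have hsum := nsmul_sum_eq_zero_of_layerMap hN (Nat.dvd_of_mem_primeFactors hpN) dvd_rfl
        (fun x hx => (Multiset.mem_filter.1 (Multiset.mem_of_le hT hx)).2 ▸
          addOrderOf_nsmul_eq_zero x) hT'sum
      rw [Nat.div_self hp.pos, one_nsmul] at hsum
      exact hS T (hT.trans (Multiset.filter_le _ S)) (by rintro rfl; simp at hT'0) hsum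
    have hone : Multiset.card (S.filter fun g => addOrderOf g = 1) = 0 := by
      rw [Multiset.card_eq_zero, Multiset.filter_eq_nil]
      exact fun g hg h1 => hS.ne_zero hg (AddMonoid.addOrderOf_eq_one_iff.1 h1)
    have hsub : N.primeFactors ⊆ N.divisors := fun p hp =>
      Nat.mem_divisors.2 ⟨Nat.dvd_of_mem_primeFactors hp, hN⟩
    have halpha : alphaFn N = ∑ d ∈ N.divisors \ N.primeFactors, ((d.minFac : ℝ) - 1) / d +
        betaFn N := by
      rw [alphaFn, betaFn, ← Finset.sum_sdiff hsub]
      congr 1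
      refine Finset.sum_congr rfl fun p hp => ?_
      rw [(Nat.prime_of_mem_primeFactors hp).minFac_eq]
    rw [crossNumber_eq_sum_divisors hN S fun g _ => hNord g, ← Finset.sum_sdiff hsub, halpha,
      add_sub_cancel_right, betaFn, Finset.mul_sum, Finset.mul_sum]
    refine add_le_add (Finset.sum_le_sum fun d hd => ?_) (Finset.sum_le_sum fun p hp => ?_)
    · rw [← mul_div_assoc]
      refine div_le_div_of_nonneg_right ?_ (Nat.cast_nonneg d)
      by_cases hd1 : d = 1
      · subst hd1
        rw [hone]
        simp
      · exact hlong d (Finset.mem_sdiff.1 hd).1 hd1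
    · rw [← mul_div_assoc]
      exact div_le_div_of_nonneg_right (hprime p hp) (Nat.cast_nonneg p)

/-- Extend a zero-sumfree sequence over `⨁ C_{n_i}`, viewed inside `C_N ^ r`, by elements
`u_i * (N / n_i) / q • e_i`, where `q` runs over the maximal prime powers dividing `N / n_i`. -/
theorem exists_isZeroSumFree_extension {r N : ℕ} (hN : N ≠ 0) (n u : Fin r → ℕ)
    (hn : ∀ i, n i ∣ N) (hu : ∀ i, (u i).Coprime (N / n i))
    (S : Multiset (∀ i, ZMod (n i))) (hS : IsZeroSumFree S) :
    ∃ S' : Multiset (Fin r → ZMod N), IsZeroSumFree S' ∧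
      crossNumber S' = crossNumber S + ∑ i, ∑ p ∈ (N / n i).primeFactors,
        ((p ^ (N / n i).factorization p : ℝ) - 1) / addOrderOf (Pi.single i
          ((u i * (N / n i / p ^ (N / n i).factorization p) : ℕ) : ZMod N) : Fin r → ZMod N) := by
  classical
  have := NeZero.mk hN
  have hn0 : ∀ i, n i ≠ 0 := fun i h0 => hN (by simpa [h0] using hn i)
  let Q : Fin r → ℕ := fun i => N / n i
  have hQN : ∀ i, Q i ∣ N := fun i => Nat.div_dvd_of_dvd (hn i)
  have hnQ : ∀ i, n i * Q i = N := fun i => Nat.mul_div_cancel' (hn i)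
  have hQ0 : ∀ i, Q i ≠ 0 := fun i h0 => hN (by simpa [h0] using (hnQ i).symm)
  -- the embedding of `∏ C_{n_i}` as `∏ Q_i C_N`
  let emb : ∀ i, ZMod (n i) →+ ZMod N := fun i =>
    ZMod.lift (n i) ⟨(AddMonoidHom.mulLeft ((Q i : ℕ) : ZMod N)).comp (Int.castAddHom (ZMod N)), by
      have : ((Q i * n i : ℕ) : ZMod N) = 0 := by rw [mul_comm, hnQ, ZMod.natCast_self]
      simpa using this⟩
  have hemb : ∀ i (z : ℤ), emb i (z : ZMod (n i)) = ((Q i : ℕ) : ZMod N) * (z : ZMod N) :=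
    fun i z => by simp [emb]
  have hembinj : ∀ i, Function.Injective (emb i) := by
    intro i
    refine (injective_iff_map_eq_zero (emb i)).2 fun a ha => ?_
    obtain ⟨z, rfl⟩ := ZMod.intCast_surjective a
    rw [hemb] at ha
    have hz : (((Q i : ℕ) * z : ℤ) : ZMod N) = 0 := by exact_mod_cast ha
    rw [ZMod.intCast_zmod_eq_zero_iff_dvd, ← hnQ i, Nat.cast_mul, mul_comm (n i : ℤ)] at hz
    rw [ZMod.intCast_zmod_eq_zero_iff_dvd]
    exact Int.dvd_of_mul_dvd_mul_left (by exact_mod_cast hQ0 i) hz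
  let E : (∀ i, ZMod (n i)) →+ (Fin r → ZMod N) :=
    AddMonoidHom.pi fun i => (emb i).comp (Pi.evalAddMonoidHom _ i)
  have hE : ∀ x i, E x i = emb i (x i) := fun _ _ => rfl
  have hEinj : Function.Injective E := fun x y hxy => funext fun i => hembinj i (congrFun hxy i)
  let q : (Σ _ : Fin r, ℕ) → ℕ := fun a => a.2 ^ (Q a.1).factorization a.2
  have hqQ : ∀ a, q a ∣ Q a.1 := fun a => Nat.ordProj_dvd _ _
  let F : Finset (Σ _ : Fin r, ℕ) := Finset.univ.sigma fun i => (Q i).primeFactors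
  let x : (Σ _ : Fin r, ℕ) → Fin r → ZMod N := fun a =>
    Pi.single a.1 ((u a.1 * (Q a.1 / q a) : ℕ) : ZMod N)
  let f : ∀ a : (Σ _ : Fin r, ℕ), (Fin r → ZMod N) →+ ZMod (q a) := fun a =>
    (ZMod.castHom ((hqQ a).trans (hQN a.1)) (ZMod (q a))).toAddMonoidHom.comp
      (Pi.evalAddMonoidHom _ a.1)
  have hf : ∀ a y, f a y = ZMod.castHom ((hqQ a).trans (hQN a.1)) (ZMod (q a)) (y a.1) :=
    fun _ _ => rfl
  have hfree : IsZeroSumFree (S.map E + ∑ a ∈ F, Multiset.replicate (q a - 1) (x a)) := by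
    refine (hS.map hEinj).add_sum_replicate F f x q ?_ ?_ ?_ ?_
    · intro a _ g hg
      obtain ⟨y, -, rfl⟩ := Multiset.mem_map.1 hg
      obtain ⟨z, hz⟩ := ZMod.intCast_surjective (y a.1)
      rw [hf, hE, ← hz, hemb, map_mul, map_natCast, (ZMod.natCast_eq_zero_iff _ _).2 (hqQ a),
        zero_mul]
    · rintro ⟨i, p⟩ ha ⟨j, l⟩ hb hne
      rw [hf]
      by_cases hij : j = i
      · subst hij
        have hlp : l ≠ p := fun h => hne (by rw [h])
        have hp := Nat.prime_of_mem_primeFactors (Finset.mem_sigma.1 ha).2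
        have hl := Nat.prime_of_mem_primeFactors (Finset.mem_sigma.1 hb).2
        simp only [x, Pi.single_eq_same]
        rw [map_natCast, ZMod.natCast_eq_zero_iff]
        refine Dvd.dvd.mul_left ?_ _
        refine Nat.Coprime.dvd_of_dvd_mul_left (m := q ⟨j, l⟩) ?_ ?_
        · exact Nat.Coprime.pow _ _ ((Nat.coprime_primes hp hl).2 hlp.symm)
        · rw [Nat.mul_div_cancel' (hqQ ⟨j, l⟩)]
          exact hqQ ⟨j, p⟩
      · simp only [x]
        rw [Pi.single_eq_of_ne (Ne.symm hij), map_zero]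
    · intro a ha
      exact pow_pos (Nat.prime_of_mem_primeFactors (Finset.mem_sigma.1 ha).2).pos _
    · rintro ⟨i, p⟩ ha
      have hp := Nat.prime_of_mem_primeFactors (Finset.mem_sigma.1 ha).2
      have hq0 : q ⟨i, p⟩ ≠ 0 := pow_ne_zero _ hp.ne_zero
      rw [hf]
      simp only [x, Pi.single_eq_same]
      rw [map_natCast, ZMod.addOrderOf_coe _ hq0]
      have hcop : (q ⟨i, p⟩).Coprime (u i * (Q i / q ⟨i, p⟩)) :=
        Nat.Coprime.mul_right ((hu i).symm.coprime_dvd_left (hqQ ⟨i, p⟩))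
          ((Nat.coprime_ordCompl hp (hQ0 i)).pow_left _)
      rw [Nat.Coprime.gcd_eq_one hcop, Nat.div_one]
  refine ⟨_, hfree, ?_⟩
  rw [crossNumber_add, crossNumber_map hEinj, crossNumber_sum, Finset.sum_sigma]
  congr 1
  refine Finset.sum_congr rfl fun i _ => Finset.sum_congr rfl fun p hp => ?_
  have hpp := Nat.prime_of_mem_primeFactors hp
  rw [crossNumber_replicate, Nat.cast_pred (pow_pos hpp.pos _)]
  simp [q, Q, x]

theorem sub_nonneg_of_prime_pow {p k : ℕ} (hp : p.Prime) : 0 ≤ (p ^ k : ℝ) - 1 :=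
  sub_nonneg.2 (one_le_pow₀ (by exact_mod_cast hp.one_le))

theorem littleCrossNumber_le {G : Type*} [AddCommGroup G] {B : ℝ}
    (h : ∀ S : Multiset G, IsZeroSumFree S → crossNumber S ≤ B) : littleCrossNumber G ≤ B :=
  csSup_le ⟨_, 0, isZeroSumFree_zero, rfl⟩ (by rintro _ ⟨S, hS, rfl⟩; exact h S hS)

theorem stmt5 (r : ℕ) (hr : 0 < r) (n : Fin r → ℕ)
    (hn : ∀ i, 1 < n i) (hdvd : ∀ i j : Fin r, i ≤ j → n i ∣ n j)
    (N : ℕ) (hN : N = n ⟨r - 1, by omega⟩)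
    (c : ℝ) (hc : 0 < c)
    (hcEta : ∀ p : ℕ, p.Prime → (etaConst (Fin r → ZMod p) : ℝ) ≤ c * (p - 1) + 1) :
    littleCrossNumber (∀ i : Fin r, ZMod (n i)) ≤
      c * (alphaFn N - betaFn N) + r * betaFn N - kStarTuple (fun i : Fin r => N / n i) / N ∧
    ((∀ i, Nat.gcd (n i) (N / n i) = 1) →
      littleCrossNumber (∀ i : Fin r, ZMod (n i)) ≤
        c * (alphaFn N - betaFn N) + r * betaFn N - kStarTuple (fun i : Fin r => N / n i)) := by
  have hnN : ∀ i, n i ∣ N := fun i => hN ▸ hdvd i _ (Fin.le_def.2 (by simp; omega))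
  have hN0 : N ≠ 0 := hN ▸ (zero_lt_one.trans (hn _)).ne'
  have := NeZero.mk hN0
  have hupper := crossNumber_le_of_isZeroSumFree hr hN0 c hcEta
  have hNpos : (0 : ℝ) < N := by exact_mod_cast Nat.pos_of_ne_zero hN0
  constructor
  · refine littleCrossNumber_le fun S hS => ?_
    obtain ⟨S', hS', hcross⟩ :=
      exists_isZeroSumFree_extension hN0 n 1 hnN (fun i => Nat.coprime_one_left _) S hS
    refine le_sub_iff_add_le.2 (le_trans ?_ (hupper S' hS'))
    rw [hcross, kStarTuple, Finset.sum_div]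
    refine add_le_add_right (Finset.sum_le_sum fun i _ => ?_) _
    rw [Finset.sum_div]
    refine Finset.sum_le_sum fun p hp => ?_
    have hpp := Nat.prime_of_mem_primeFactors hp
    rw [div_div]
    refine div_le_div_of_nonneg_left (sub_nonneg_of_prime_pow hpp)
      (by exact_mod_cast addOrderOf_pos _) ?_
    have hle : addOrderOf (Pi.single i (((1 : Fin r → ℕ) i *
        (N / n i / p ^ (N / n i).factorization p) : ℕ) : ZMod N) : Fin r → ZMod N) ≤ N :=
      Nat.le_of_dvd (Nat.pos_of_ne_zero hN0)
        (addOrderOf_dvd_of_nsmul_eq_zero (by funext j; simp))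
    refine le_trans (by exact_mod_cast hle) (le_mul_of_one_le_left hNpos.le ?_)
    exact one_le_pow₀ (by exact_mod_cast hpp.one_le)
  · intro hcop
    refine littleCrossNumber_le fun S hS => ?_
    obtain ⟨S', hS', hcross⟩ := exists_isZeroSumFree_extension hN0 n n hnN hcop S hS
    refine le_sub_iff_add_le.2 (le_trans ?_ (hupper S' hS'))
    rw [hcross, kStarTuple]
    refine add_le_add_right (Finset.sum_le_sum fun i _ => Finset.sum_le_sum fun p hp => ?_) _
    have hpp := Nat.prime_of_mem_primeFactors hp
    refine div_le_div_of_nonneg_left (sub_nonneg_of_prime_pow hpp)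
      (by exact_mod_cast addOrderOf_pos _) ?_
    have hle : addOrderOf (Pi.single i ((n i *
        (N / n i / p ^ (N / n i).factorization p) : ℕ) : ZMod N) : Fin r → ZMod N) ≤
          p ^ (N / n i).factorization p := by
      refine Nat.le_of_dvd (pow_pos hpp.pos _) (addOrderOf_dvd_of_nsmul_eq_zero ?_)
      rw [← Pi.single_smul, nsmul_eq_mul, ← Nat.cast_mul, mul_left_comm,
        Nat.mul_div_cancel' (Nat.ordProj_dvd _ _), Nat.mul_div_cancel' (hnN i), ZMod.natCast_self,
        Pi.single_zero]
    exact_mod_cast hle
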